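/- Let A ∈ ℝ^{n×n} be a Metzler matrix and B ∈ ℝ^{n×n} a nonnegative matrix, and consider the delayed linear system G_L: ẋ(t) = A x(t) + B x(t−τ(t)) for t ≥ 0, with x(t) = φ(t) on [−τ_max, 0]. Then G_L is globally asymptotically stable for every nonnegative continuous initial condition φ and for every delay τ satisfying Assumption A if and only if there exists a vector v > 0 such that (A + B)v < 0 (componentwise). -/

import Mathlib

open Real Filter Set Asymptotics

/-- A vector field `f : ℝⁿ → ℝⁿ` is *cooperative* if it is continuous on `ℝⁿ`,
continuously differentiable on `ℝⁿ \ {0}`, and its Jacobian matrix is Metzler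
(off-diagonal entries nonnegative) at every point of the nonnegative orthant minus the origin. -/
def Cooperative (n : ℕ) (f : (Fin n → ℝ) → Fin n → ℝ) : Prop :=
  Continuous f ∧ ContDiffOn ℝ 1 f {x | x ≠ 0} ∧
    ∀ x : Fin n → ℝ, (∀ i, 0 ≤ x i) → x ≠ 0 →
      ∀ i j, i ≠ j → 0 ≤ fderiv ℝ f x (Pi.single j 1) i

/-- A vector field `g` is non-decreasing on the nonnegative orthant. -/
def NonDecOn (n : ℕ) (g : (Fin n → ℝ) → Fin n → ℝ) : Prop :=
  ∀ x y : Fin n → ℝ, (∀ i, 0 ≤ y i) → (∀ i, y i ≤ x i) → ∀ i, g y i ≤ g x i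

/-- `f` is homogeneous of degree `p` with respect to the dilation map `δ_λ^r`. -/
def Homogeneous (n : ℕ) (r : Fin n → ℝ) (p : ℝ) (f : (Fin n → ℝ) → Fin n → ℝ) : Prop :=
  ∀ (x : Fin n → ℝ) (l : ℝ), 0 < l →
    f (fun i => l ^ r i * x i) = fun i => l ^ p * (l ^ r i * f x i)

/-- Assumption A on the delay: `τ` is a continuous nonnegative delay with
`t - τ(t) → ∞`, and `τmax ≥ 0` bounds the initial-history window:
`t - τ(t) ≥ -τmax` for all `t ≥ 0`. -/
def DelayA (τ : ℝ → ℝ) (τmax : ℝ) : Prop :=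
  ContinuousOn τ (Ici 0) ∧ (∀ t, 0 ≤ t → 0 ≤ τ t) ∧
    Tendsto (fun t => t - τ t) atTop atTop ∧
    0 ≤ τmax ∧ ∀ t, 0 ≤ t → -τmax ≤ t - τ t

/-- A solution of the delayed system `ẋ(t) = f(x(t)) + g(x(t - τ(t)))`, `t ≥ 0`,
with initial condition `φ` on `[-τmax, 0]`. -/
def IsSolution (n : ℕ) (f g : (Fin n → ℝ) → Fin n → ℝ) (τ : ℝ → ℝ) (τmax : ℝ)
    (φ x : ℝ → Fin n → ℝ) : Prop :=
  ContinuousOn x (Ici (-τmax)) ∧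
    (∀ t ∈ Icc (-τmax) (0 : ℝ), x t = φ t) ∧
    ∀ t, 0 ≤ t → HasDerivAt x (f (x t) + g (x (t - τ t))) t

/-- A nonnegative continuous initial condition on `[-τmax, 0]`. -/
def NonnegInit (n : ℕ) (τmax : ℝ) (φ : ℝ → Fin n → ℝ) : Prop :=
  ContinuousOn φ (Icc (-τmax) 0) ∧ ∀ t ∈ Icc (-τmax) (0 : ℝ), ∀ i, 0 ≤ φ t i

/-- Global asymptotic stability of the delayed system: Lyapunov stability of the origin plus
global attractivity over nonnegative continuous initial conditions. -/
def GAS (n : ℕ) (f g : (Fin n → ℝ) → Fin n → ℝ) (τ : ℝ → ℝ) (τmax : ℝ) : Prop :=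
  (∀ ε > (0 : ℝ), ∃ δ > (0 : ℝ), ∀ φ x : ℝ → Fin n → ℝ,
      NonnegInit n τmax φ → IsSolution n f g τ τmax φ x →
      (∀ s ∈ Icc (-τmax) (0 : ℝ), ‖φ s‖ < δ) → ∀ t, 0 ≤ t → ‖x t‖ < ε) ∧
  ∀ φ x : ℝ → Fin n → ℝ, NonnegInit n τmax φ → IsSolution n f g τ τmax φ x →
      Tendsto x atTop (nhds 0)

/-- If the map attains at `t` a value strictly above all its earlier values on `[a, t)`,
then its derivative there is nonnegative. -/
lemma HasDerivAt.nonneg_of_forall_lt {f : ℝ → ℝ} {f' a t : ℝ} (hf : HasDerivAt f f' t)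
    (hat : a < t) (h : ∀ s, a ≤ s → s < t → f s < f t) : 0 ≤ f' := by
  have hlim : Tendsto (slope f t) (nhdsWithin t (Iio t)) (nhds f') :=
    (hasDerivAt_iff_tendsto_slope.1 hf).mono_left
      (nhdsWithin_mono t fun s (hs : s < t) => hs.ne)
  refine ge_of_tendsto hlim ?_
  filter_upwards [Ioo_mem_nhdsLT hat] with s hs
  rw [slope_def_field]
  exact div_nonneg_of_nonpos (by linarith [h s hs.1.le hs.2]) (by linarith [hs.2])

/-- A function which decreases at a uniform rate while it is at least `K` is eventually
at most `K`. -/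
lemma eventually_le_of_deriv_le_neg {f f' : ℝ → ℝ} {T K c : ℝ} (hc : 0 < c)
    (hf : ∀ t, T ≤ t → HasDerivAt f (f' t) t) (h : ∀ t, T ≤ t → K ≤ f t → f' t ≤ -c) :
    ∀ᶠ t in atTop, f t ≤ K := by
  obtain ⟨t₁, ht₁, hft₁⟩ : ∃ t₁, T ≤ t₁ ∧ f t₁ ≤ K := by
    by_contra! hK
    have hle : ∀ t, T ≤ t → f t ≤ f T + -c * (t - T) := by
      intro t ht
      have hline : ∀ s, HasDerivAt (fun s => f T + -c * (s - T)) (-c) s := fun s => by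
        simpa using (((hasDerivAt_id s).sub_const T).const_mul (-c)).const_add (f T)
      refine image_le_of_deriv_right_le_deriv_boundary (a := T) (b := t) (f' := f')
        (B := fun s => f T + -c * (s - T)) (B' := fun _ => -c)
        (fun s hs => (hf s hs.1).continuousAt.continuousWithinAt)
        (fun s hs => (hf s hs.1).hasDerivWithinAt) (by simp)
        (fun s _ => (hline s).continuousAt.continuousWithinAt)
        (fun s _ => (hline s).hasDerivWithinAt)
        (fun s hs => h s hs.1 (hK s hs.1).le) ⟨ht, le_rfl⟩
    have hd : 0 ≤ (f T - K) / c := div_nonneg (by linarith [hK T le_rfl]) hc.le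
    have h1 := hle (T + (f T - K) / c) (by linarith)
    have h2 := hK (T + (f T - K) / c) (by linarith)
    have h3 : c * ((f T - K) / c) = f T - K := mul_div_cancel₀ _ hc.ne'
    linarith [h3, h1, h2, show -c * (T + (f T - K) / c - T) = -(c * ((f T - K) / c)) by ring]
  filter_upwards [eventually_ge_atTop t₁] with t ht
  refine image_le_of_deriv_right_lt_deriv_boundary (a := t₁) (b := t) (f' := f')
    (B := fun _ => K) (B' := fun _ => 0)
    (fun s hs => (hf s (ht₁.trans hs.1)).continuousAt.continuousWithinAt)
    (fun s hs => (hf s (ht₁.trans hs.1)).hasDerivWithinAt) hft₁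
    (fun s => hasDerivAt_const s K) (fun s hs hsK => ?_) ⟨ht, le_rfl⟩
  linarith [h s (ht₁.trans hs.1) hsK.ge]

section DelayedLinear

variable {ι : Type*} [Fintype ι] {A B : Matrix ι ι ℝ} {v : ι → ℝ}

lemma Matrix.mulVec_mono_of_nonneg (hB : ∀ i j, 0 ≤ B i j) {x y : ι → ℝ} (hxy : ∀ j, x j ≤ y j)
    (i : ι) : B.mulVec x i ≤ B.mulVec y i :=
  Finset.sum_le_sum fun j _ => mul_le_mul_of_nonneg_left (hxy j) (hB i j)

/-- The monotonicity defect of a Metzler matrix is its diagonal. -/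
lemma Matrix.mulVec_le_of_metzler (hA : ∀ i j, i ≠ j → 0 ≤ A i j) {x y : ι → ℝ}
    (hxy : ∀ j, x j ≤ y j) (i : ι) :
    A.mulVec x i ≤ A.mulVec y i - A i i * (y i - x i) := by
  classical
  have h : A i i * (y i - x i) ≤ ∑ j, A i j * (y j - x j) := by
    rw [← Finset.add_sum_erase _ _ (Finset.mem_univ i)]
    refine le_add_of_nonneg_right (Finset.sum_nonneg fun j hj => ?_)
    exact mul_nonneg (hA i j (Finset.ne_of_mem_erase hj).symm) (sub_nonneg.2 (hxy j))
  have h2 : ∑ j, A i j * (y j - x j) = A.mulVec y i - A.mulVec x i := by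
    simp [Matrix.mulVec, dotProduct, mul_sub]
  linarith

lemma Matrix.diag_nonpos_of_metzler (hA : ∀ i j, i ≠ j → 0 ≤ A i j) (hB : ∀ i j, 0 ≤ B i j)
    (hv : ∀ i, 0 < v i) (hAB : ∀ i, (A + B).mulVec v i < 0) (i : ι) : A i i ≤ 0 := by
  have h1 := Matrix.mulVec_le_of_metzler hA (x := 0) (fun j => (hv j).le) i
  have h2 := Matrix.mulVec_mono_of_nonneg hB (x := 0) (fun j => (hv j).le) i
  have h3 := hAB i
  simp only [Matrix.add_mulVec, Matrix.mulVec_zero, Pi.add_apply, Pi.zero_apply] at h1 h2 h3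
  by_contra! h
  nlinarith [hv i]

/-- Bound on the vector field below the barrier `m • v`, in a component above `κ * m * v i`. -/
lemma delayed_field_le (hA : ∀ i j, i ≠ j → 0 ≤ A i j) (hB : ∀ i j, 0 ≤ B i j)
    (hv : ∀ i, 0 < v i) (hAB : ∀ i, (A + B).mulVec v i < 0) {m κ : ℝ} {x z : ι → ℝ}
    (hx : ∀ j, x j ≤ m * v j) (hz : ∀ j, z j ≤ m * v j) {i : ι} (hi : κ * m * v i ≤ x i) :
    A.mulVec x i + B.mulVec z i ≤ m * ((A + B).mulVec v i - (1 - κ) * (A i i * v i)) := by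
  have h1 := Matrix.mulVec_le_of_metzler hA (y := m • v) hx i
  have h2 := Matrix.mulVec_mono_of_nonneg hB (y := m • v) hz i
  have h3 := mul_le_mul_of_nonpos_left hi (Matrix.diag_nonpos_of_metzler hA hB hv hAB i)
  simp only [Matrix.mulVec_smul, Pi.smul_apply, smul_eq_mul] at h1 h2
  simp only [Matrix.add_mulVec, Pi.add_apply]
  linarith

/-- The region below `m • v` is invariant. -/
lemma delayed_solution_lt_barrier (hA : ∀ i j, i ≠ j → 0 ≤ A i j) (hB : ∀ i j, 0 ≤ B i j)
    (hv : ∀ i, 0 < v i) (hAB : ∀ i, (A + B).mulVec v i < 0) {τ : ℝ → ℝ} {τmax : ℝ}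
    (hτ : DelayA τ τmax) {x : ℝ → ι → ℝ}
    (hder : ∀ t, 0 ≤ t → HasDerivAt x (A.mulVec (x t) + B.mulVec (x (t - τ t))) t)
    {m : ℝ} (hm : 0 < m) (hinit : ∀ s ∈ Icc (-τmax) 0, ∀ i, x s i < m * v i) :
    ∀ t, -τmax ≤ t → ∀ i, x t i < m * v i := by
  obtain ⟨-, hτ0, -, hτm, hτlb⟩ := hτ
  by_contra! hcon
  obtain ⟨t₁, ht₁, i₁, hi₁⟩ := hcon
  have ht₁0 : 0 ≤ t₁ := by
    by_contra! h
    exact (hinit t₁ ⟨ht₁, h.le⟩ i₁).not_ge hi₁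
  have hcont : ∀ t, 0 ≤ t → ∀ i, ContinuousAt (fun s => x s i) t := fun t ht i =>
    ((hasDerivAt_pi.1 (hder t ht)) i).continuousAt
  have hcomp : IsCompact (⋃ i, {t ∈ Icc 0 t₁ | m * v i ≤ x t i}) :=
    isCompact_iUnion fun i => isCompact_Icc.of_isClosed_subset
      (isClosed_Icc.isClosed_le continuousOn_const
        fun t ht => (hcont t ht.1 i).continuousWithinAt) (sep_subset _ _)
  obtain ⟨t, ht, hmin⟩ := hcomp.exists_isLeast ⟨t₁, mem_iUnion.2 ⟨i₁, ⟨ht₁0, le_rfl⟩, hi₁⟩⟩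
  obtain ⟨i, ⟨ht0, htt₁⟩, hi⟩ := mem_iUnion.1 ht
  have hbefore : ∀ s, -τmax ≤ s → s < t → ∀ j, x s j < m * v j := by
    intro s hs hst j
    by_contra! h
    rcases le_total s 0 with h0 | h0
    · exact (hinit s ⟨hs, h0⟩ j).not_ge h
    · exact hst.not_ge (hmin (mem_iUnion.2 ⟨j, ⟨h0, hst.le.trans htt₁⟩, h⟩))
  have htpos : 0 < t := ht0.lt_of_ne fun h =>
    (hinit t ⟨by linarith, h.ge⟩ i).not_ge hi
  have hle : ∀ j, x t j ≤ m * v j := by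
    intro j
    have hlim : Tendsto (fun s => x s j) (nhdsWithin t (Iio t)) (nhds (x t j)) :=
      (hcont t ht0 j).tendsto.mono_left nhdsWithin_le_nhds
    refine le_of_tendsto hlim ?_
    filter_upwards [Ioo_mem_nhdsLT htpos] with s hs
    exact (hbefore s (by linarith [hs.1]) hs.2 j).le
  have hdelay : ∀ j, x (t - τ t) j ≤ m * v j := by
    intro j
    rcases (hτ0 t ht0).eq_or_lt with h | h
    · simpa [← h] using hle j
    · exact (hbefore _ (hτlb t ht0) (by linarith) j).le
  have hnonneg := (hasDerivAt_pi.1 (hder t ht0) i).nonneg_of_forall_lt htpos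
    fun s hs hst => (hbefore s (by linarith) hst i).trans_le hi
  have hfield := delayed_field_le hA hB hv hAB hle hdelay (κ := 1) (i := i) (by simpa using hi)
  simp only [Pi.add_apply] at hnonneg
  nlinarith [hAB i]

lemma exists_contraction_factor (hAB : ∀ i, (A + B).mulVec v i < 0) :
    ∃ κ : ℝ, 0 < κ ∧ κ < 1 ∧ ∀ i, (A + B).mulVec v i - (1 - κ) * (A i i * v i) < 0 := by
  have h : ∀ᶠ κ : ℝ in nhdsWithin 1 (Iio 1),
      ∀ i, (A + B).mulVec v i - (1 - κ) * (A i i * v i) < 0 := by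
    refine eventually_all.2 fun i => nhdsWithin_le_nhds ?_
    have hc : Continuous fun κ : ℝ => (A + B).mulVec v i - (1 - κ) * (A i i * v i) := by
      fun_prop
    exact hc.continuousAt.eventually_lt continuousAt_const (by simpa using hAB i)
  obtain ⟨κ, hκ, h0, h1⟩ := (h.and (Ioo_mem_nhdsLT zero_lt_one)).exists
  exact ⟨κ, h0, h1, hκ⟩

/-- A solution below a barrier `m₀ • v` eventually lies below each barrier `b • v` with `b > 0`. -/
lemma delayed_solution_eventually_le (hA : ∀ i j, i ≠ j → 0 ≤ A i j) (hB : ∀ i j, 0 ≤ B i j)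
    (hv : ∀ i, 0 < v i) (hAB : ∀ i, (A + B).mulVec v i < 0) {τ : ℝ → ℝ}
    (hτ : Tendsto (fun t => t - τ t) atTop atTop) {x : ℝ → ι → ℝ}
    (hder : ∀ t, 0 ≤ t → HasDerivAt x (A.mulVec (x t) + B.mulVec (x (t - τ t))) t)
    {m₀ : ℝ} (hm₀ : 0 < m₀) (hbound : ∀ᶠ t in atTop, ∀ i, x t i ≤ m₀ * v i)
    {b : ℝ} (hb : 0 < b) : ∀ᶠ t in atTop, ∀ i, x t i ≤ b * v i := by
  obtain ⟨κ, hκ0, hκ1, hκ⟩ := exists_contraction_factor hAB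
  have hstep : ∀ k : ℕ, ∀ᶠ t in atTop, ∀ i, x t i ≤ κ ^ k * m₀ * v i := by
    intro k
    induction k with
    | zero => simpa using hbound
    | succ k ih =>
      have hm : 0 < κ ^ k * m₀ := by positivity
      obtain ⟨T, hT⟩ := eventually_atTop.1
        ((ih.and (hτ.eventually ih)).and (eventually_ge_atTop 0))
      refine eventually_all.2 fun i => ?_
      refine eventually_le_of_deriv_le_neg (T := T)
        (f' := fun t => A.mulVec (x t) i + B.mulVec (x (t - τ t)) i)
        (c := -(κ ^ k * m₀ * ((A + B).mulVec v i - (1 - κ) * (A i i * v i))))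
        (neg_pos.2 (mul_neg_of_pos_of_neg hm (hκ i)))
        (fun t ht => hasDerivAt_pi.1 (hder t (hT t ht).2) i) fun t ht hKt => ?_
      rw [neg_neg]
      exact delayed_field_le hA hB hv hAB (hT t ht).1.1 (hT t ht).1.2
        (by rwa [pow_succ', mul_assoc κ] at hKt)
  obtain ⟨k, hk⟩ := exists_pow_lt_of_lt_one (div_pos hb hm₀) hκ1
  filter_upwards [hstep k] with t ht i
  exact (ht i).trans (mul_le_mul_of_nonneg_right ((lt_div_iff₀ hm₀).1 hk).le (hv i).le)

end DelayedLinear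

lemma GAS_of_exists_pos {n : ℕ} {A B : Matrix (Fin n) (Fin n) ℝ} {v : Fin n → ℝ}
    (hA : ∀ i j, i ≠ j → 0 ≤ A i j) (hB : ∀ i j, 0 ≤ B i j)
    (hv : ∀ i, 0 < v i) (hAB : ∀ i, (A + B).mulVec v i < 0) {τ : ℝ → ℝ} {τmax : ℝ}
    (hτ : DelayA τ τmax) :
    GAS n (fun x => A.mulVec x) (fun x => B.mulVec x) τ τmax := by
  have hneg : ∀ {x : ℝ → Fin n → ℝ},
      (∀ t, 0 ≤ t → HasDerivAt x (A.mulVec (x t) + B.mulVec (x (t - τ t))) t) →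
      ∀ t, 0 ≤ t → HasDerivAt (-x) (A.mulVec ((-x) t) + B.mulVec ((-x) (t - τ t))) t := by
    intro x hx t ht
    refine (hx t ht).neg.congr_deriv ?_
    simp only [Pi.neg_apply, Matrix.mulVec_neg, neg_add]
  have hinv : ∀ {x : ℝ → Fin n → ℝ} {m : ℝ}, 0 < m →
      (∀ t, 0 ≤ t → HasDerivAt x (A.mulVec (x t) + B.mulVec (x (t - τ t))) t) →
      (∀ s ∈ Icc (-τmax) 0, ∀ i, |x s i| < m * v i) →
      ∀ t, -τmax ≤ t → ∀ i, |x t i| < m * v i := by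
    intro x m hm hx hinit t ht i
    have h1 := delayed_solution_lt_barrier hA hB hv hAB hτ hx hm
      (fun s hs j => (le_abs_self _).trans_lt (hinit s hs j)) t ht i
    have h2 := delayed_solution_lt_barrier hA hB hv hAB hτ (hneg hx) hm
      (fun s hs j => (neg_le_abs _).trans_lt (hinit s hs j)) t ht i
    exact abs_lt.2 ⟨neg_lt.1 h2, h1⟩
  have hsmall : ∀ ε : ℝ, 0 < ε → ∃ b : ℝ, 0 < b ∧ ∀ i, b * v i < ε := by
    intro ε hε
    have h : ∀ᶠ b : ℝ in nhdsWithin 0 (Ioi 0), ∀ i, b * v i < ε :=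
      eventually_all.2 fun i => nhdsWithin_le_nhds <|
        (continuous_mul_const (v i)).continuousAt.eventually_lt continuousAt_const
          (by simpa using hε)
    obtain ⟨b, hb, hb0⟩ := (h.and self_mem_nhdsWithin).exists
    exact ⟨b, hb0, hb⟩
  constructor
  · intro ε hε
    obtain ⟨m, hm, hmε⟩ := hsmall ε hε
    have hδ : ∀ᶠ δ : ℝ in nhdsWithin 0 (Ioi 0), ∀ i, δ < m * v i :=
      eventually_all.2 fun i => nhdsWithin_le_nhds (gt_mem_nhds (mul_pos hm (hv i)))
    obtain ⟨δ, hδm, hδ0⟩ := (hδ.and self_mem_nhdsWithin).exists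
    refine ⟨δ, hδ0, fun φ x _ hx hφδ t ht => (pi_norm_lt_iff hε).2 fun i => ?_⟩
    refine (hinv hm hx.2.2 (fun s hs j => ?_) t (by linarith [hτ.2.2.2.1]) i).trans (hmε i)
    rw [hx.2.1 s hs]
    exact ((norm_le_pi_norm (φ s) j).trans_lt (hφδ s hs)).trans (hδm j)
  · intro φ x _ hx
    obtain ⟨C, hC⟩ := isCompact_Icc.exists_bound_of_continuousOn
      (hx.1.mono (Icc_subset_Ici_self : Icc (-τmax) 0 ⊆ Ici (-τmax)))
    obtain ⟨m, hmC, hm⟩ : ∃ m : ℝ, (∀ i, C < m * v i) ∧ 0 < m :=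
      ((eventually_all.2 fun i => (tendsto_id.atTop_mul_const (hv i)).eventually_gt_atTop C).and
        (eventually_gt_atTop 0)).exists
    have hbound : ∀ᶠ t in atTop, ∀ i, |x t i| ≤ m * v i := by
      filter_upwards [eventually_ge_atTop (-τmax)] with t ht i
      exact (hinv hm hx.2.2 (fun s hs j =>
        ((norm_le_pi_norm (x s) j).trans (hC s hs)).trans_lt (hmC j)) t ht i).le
    rw [NormedAddGroup.tendsto_nhds_zero]
    intro ε hε
    obtain ⟨b, hb, hbε⟩ := hsmall ε hε
    filter_upwards [delayed_solution_eventually_le hA hB hv hAB hτ.2.2.1 hx.2.2 hm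
        (hbound.mono fun t ht i => (le_abs_self _).trans (ht i)) hb,
      delayed_solution_eventually_le hA hB hv hAB hτ.2.2.1 (hneg hx.2.2) hm
        (hbound.mono fun t ht i => (neg_le_abs _).trans (ht i)) hb] with t h1 h2
    refine (pi_norm_lt_iff hε).2 fun i => (abs_le.2 ⟨?_, h1 i⟩).trans_lt (hbε i)
    exact neg_le.1 (h2 i)

/-- The exponential of an operator preserving the nonnegative orthant preserves it as well. -/
lemma exp_apply_nonneg {ι : Type*} [Fintype ι] {P : (ι → ℝ) →L[ℝ] (ι → ℝ)}
    (hP : ∀ x, 0 ≤ x → 0 ≤ P x) {x : ι → ℝ} (hx : 0 ≤ x) : 0 ≤ NormedSpace.exp P x := by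
  have hpow : ∀ k : ℕ, 0 ≤ (P ^ k) x := by
    intro k
    induction k with
    | zero => simpa using hx
    | succ k ih => simpa [pow_succ'] using hP _ ih
  have hsum := (NormedSpace.exp_series_hasSum_exp' (𝕂 := ℝ) P).mapL
    (ContinuousLinearMap.apply ℝ (ι → ℝ) x)
  refine hsum.nonneg fun k => ?_
  simpa using smul_nonneg (by positivity : (0 : ℝ) ≤ (k.factorial : ℝ)⁻¹) (hpow k)

/-- The linear system of a Metzler matrix has a nonnegative solution starting at the all-ones
vector. -/
lemma Matrix.exists_nonneg_solution_of_metzler {ι : Type*} [Fintype ι] {M : Matrix ι ι ℝ}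
    (hM : ∀ i j, i ≠ j → 0 ≤ M i j) :
    ∃ x : ℝ → ι → ℝ, x 0 = 1 ∧ (∀ t, 0 ≤ t → 0 ≤ x t) ∧
      ∀ t, HasDerivAt x (M.mulVec (x t)) t := by
  obtain ⟨c, hc⟩ : ∃ c : ℝ, ∀ i, -M i i ≤ c :=
    (eventually_all.2 fun i => eventually_ge_atTop (-M i i)).exists
  let P : (ι → ℝ) →L[ℝ] (ι → ℝ) :=
    M.mulVecLin.toContinuousLinearMap + c • ContinuousLinearMap.id ℝ (ι → ℝ)
  have hPx : ∀ x, P x = M.mulVec x + c • x := fun x => rfl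
  have hP : ∀ x, 0 ≤ x → 0 ≤ P x := by
    intro x hx i
    have h := Matrix.mulVec_le_of_metzler hM (x := 0) hx i
    have h2 := mul_le_mul_of_nonneg_right (hc i) (hx i)
    simp only [Matrix.mulVec_zero, Pi.zero_apply, sub_zero] at h
    simp only [hPx, Pi.add_apply, Pi.smul_apply, smul_eq_mul, Pi.zero_apply]
    linarith
  refine ⟨fun t => Real.exp (-c * t) • NormedSpace.exp (t • P) 1, by simp, fun t ht => ?_,
    fun t => ?_⟩
  · exact smul_nonneg (Real.exp_pos _).le
      (exp_apply_nonneg (fun x hx => smul_nonneg ht (hP x hx)) zero_le_one)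
  · have h1 : HasDerivAt (fun t => Real.exp (-c * t)) (Real.exp (-c * t) * -c) t := by
      simpa using ((hasDerivAt_id t).const_mul (-c)).exp
    have h2 := (hasDerivAt_exp_smul_const' (𝕂 := ℝ) P t).clm_apply
      (hasDerivAt_const t (1 : ι → ℝ))
    refine (h1.smul h2).congr_deriv ?_
    simp only [mul_apply_eq_comp, map_zero, add_zero, hPx, Matrix.mulVec_smul]
    module

lemma Matrix.exists_pos_mulVec_neg_of_tendsto {ι : Type*} [Fintype ι] {M : Matrix ι ι ℝ}
    {x : ℝ → ι → ℝ} (hx0 : x 0 = 1) (hx : ∀ t, 0 ≤ t → 0 ≤ x t)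
    (hder : ∀ t, HasDerivAt x (M.mulVec (x t)) t) (hlim : Tendsto x atTop (nhds 0)) :
    ∃ v : ι → ℝ, (∀ i, 0 < v i) ∧ ∀ i, M.mulVec v i < 0 := by
  obtain ⟨T, hT1, hT0⟩ : ∃ T : ℝ, (∀ i, x T i < 1) ∧ 0 < T :=
    ((eventually_all.2 fun i => (tendsto_pi_nhds.1 hlim i).eventually_lt_const
      (show (0 : ι → ℝ) i < 1 from zero_lt_one)).and (eventually_gt_atTop 0)).exists
  have hcont : Continuous x := continuous_iff_continuousAt.2 fun t => (hder t).continuousAt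
  have hint : ∀ i, IntervalIntegrable (fun t => x t i) MeasureTheory.volume 0 T := fun i =>
    ((continuous_apply i).comp hcont).intervalIntegrable 0 T
  refine ⟨fun i => ∫ t in (0 : ℝ)..T, x t i, fun i => ?_, fun i => ?_⟩
  · refine intervalIntegral.integral_pos hT0 ((continuous_apply i).comp hcont).continuousOn
      (fun t ht => hx t ht.1.le i) ⟨0, ⟨le_rfl, hT0.le⟩, ?_⟩
    simp [hx0]
  · have h1 : M.mulVec (fun i => ∫ t in (0 : ℝ)..T, x t i) i
        = ∫ t in (0 : ℝ)..T, M.mulVec (x t) i := by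
      simp only [Matrix.mulVec, dotProduct]
      rw [intervalIntegral.integral_finsetSum fun j _ => (hint j).const_mul _]
      simp
    have h2 : ∫ t in (0 : ℝ)..T, M.mulVec (x t) i = x T i - x 0 i := by
      refine intervalIntegral.integral_eq_sub_of_hasDerivAt
        (fun t _ => hasDerivAt_pi.1 (hder t) i) (Continuous.intervalIntegrable ?_ 0 T)
      exact (continuous_apply i).comp (continuous_const.matrix_mulVec hcont)
    rw [h1, h2, hx0]
    exact sub_neg.2 (hT1 i)

/-- Corollary (continuous-time positive linear systems): for `A` Metzler and `B` nonnegative,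
the delayed linear system `ẋ(t) = A x(t) + B x(t-τ(t))` is globally asymptotically stable for
every delay satisfying Assumption A if and only if there exists `v > 0` with `(A+B)v < 0`. -/
theorem positive_linear_delay_independent_stability
    (n : ℕ) (A B : Matrix (Fin n) (Fin n) ℝ)
    (hA : ∀ i j, i ≠ j → 0 ≤ A i j) (hB : ∀ i j, 0 ≤ B i j) :
    (∀ τ : ℝ → ℝ, ∀ τmax : ℝ, DelayA τ τmax →
        GAS n (fun x => A.mulVec x) (fun x => B.mulVec x) τ τmax) ↔
      ∃ v : Fin n → ℝ, (∀ i, 0 < v i) ∧ ∀ i, (A + B).mulVec v i < 0 := by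
  refine ⟨fun h => ?_, fun ⟨v, hv, hAB⟩ τ τmax hτ => GAS_of_exists_pos hA hB hv hAB hτ⟩
  obtain ⟨x, hx0, hx, hder⟩ := Matrix.exists_nonneg_solution_of_metzler (M := A + B)
    fun i j hij => add_nonneg (hA i j hij) (hB i j)
  refine Matrix.exists_pos_mulVec_neg_of_tendsto hx0 hx hder ?_
  have hdelay : DelayA (fun _ => 0) 0 :=
    ⟨continuousOn_const, fun _ _ => le_rfl, tendsto_id.congr fun t => (sub_zero t).symm, le_rfl,
      fun t ht => by simpa using ht⟩
  have hcont : Continuous x := continuous_iff_continuousAt.2 fun t => (hder t).continuousAt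
  refine (h _ _ hdelay).2 x x ⟨hcont.continuousOn, fun t ht => hx t (by simpa using ht.1)⟩
    ⟨hcont.continuousOn, fun _ _ => rfl, fun t _ => ?_⟩
  simpa [Matrix.add_mulVec] using hder t
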